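/- arXiv:math/0204285 — 2 statements merged into one kernel-verified Lean document; each statement's English description precedes it below -/
import Mathlib

section
/- In Map₂, the factorization (W₁)² is Hurwitz equivalent to the concatenation ∏_{j=0}^{5} (T)_{(ζ₅ζ₄ζ₃ζ₂ζ₁)^j}, i.e. to T·(T)_{ζ₅ζ₄ζ₃ζ₂ζ₁}·(T)_{(ζ₅ζ₄ζ₃ζ₂ζ₁)²}·(T)_{(ζ₅ζ₄ζ₃ζ₂ζ₁)³}·(T)_{(ζ₅ζ₄ζ₃ζ₂ζ₁)⁴}·(T)_{(ζ₅ζ₄ζ₃ζ₂ζ₁)⁵}. -/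
/-- A single Hurwitz move: replace two consecutive entries `(x, y)` by `(x y x⁻¹, x)`. -/
def HurwitzMove {G : Type*} [Group G] (F F' : List G) : Prop :=
  ∃ (l₁ l₂ : List G) (x y : G),
    F = l₁ ++ x :: y :: l₂ ∧ F' = l₁ ++ (x * y * x⁻¹) :: x :: l₂

/-- Hurwitz equivalence: the reflexive-symmetric-transitive closure of Hurwitz moves.
(The symmetric closure accounts for the inverse move `(x, y) ↦ (y, y⁻¹ x y)`.) -/
def HurwitzEquiv {G : Type*} [Group G] : List G → List G → Prop :=
  Relation.EqvGen HurwitzMove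

/-- `n`-fold concatenation of a factorization with itself. -/
def fpow {G : Type*} (F : List G) (n : ℕ) : List G :=
  (List.replicate n F).flatten

/-- Simultaneous conjugation of all entries of a factorization by `φ`: `τ ↦ φ⁻¹ τ φ`. -/
def fconj {G : Type*} [Group G] (F : List G) (φ : G) : List G :=
  F.map fun τ => φ⁻¹ * τ * φ

/-- Generators of the free group on five letters. -/
abbrev fg (i : Fin 5) : FreeGroup (Fin 5) := FreeGroup.of i

/-- The word `ζ₁ζ₂ζ₃ζ₄ζ₅` in the free group. -/
def Δw : FreeGroup (Fin 5) := fg 0 * fg 1 * fg 2 * fg 3 * fg 4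

/-- The word `ζ₁ζ₂ζ₃ζ₄ζ₅²ζ₄ζ₃ζ₂ζ₁` in the free group. -/
def Iw : FreeGroup (Fin 5) :=
  fg 0 * fg 1 * fg 2 * fg 3 * fg 4 * fg 4 * fg 3 * fg 2 * fg 1 * fg 0

/-- Relations for the presentation of the genus-2 mapping class group `Map₂`:
commutations `ζᵢζⱼ = ζⱼζᵢ` for `|i - j| ≥ 2`, braid relations
`ζᵢζᵢ₊₁ζᵢ = ζᵢ₊₁ζᵢζᵢ₊₁`, `(ζ₁ζ₂ζ₃ζ₄ζ₅)⁶ = 1`, `I = ζ₁ζ₂ζ₃ζ₄ζ₅²ζ₄ζ₃ζ₂ζ₁` is central,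
and `I² = 1`. -/
def map2Rels : Set (FreeGroup (Fin 5)) :=
  { r | (∃ i j : Fin 5, (i : ℕ) + 2 ≤ (j : ℕ) ∧ r = fg i * fg j * (fg i)⁻¹ * (fg j)⁻¹) ∨
        (∃ i : Fin 4, r = fg i.castSucc * fg i.succ * fg i.castSucc *
          (fg i.succ * fg i.castSucc * fg i.succ)⁻¹) ∨
        r = Δw ^ 6 ∨
        (∃ i : Fin 5, r = Iw * fg i * Iw⁻¹ * (fg i)⁻¹) ∨
        r = Iw ^ 2 }

/-- The mapping class group of a closed genus-2 surface, via its standard presentation. -/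
abbrev Map₂ : Type := PresentedGroup map2Rels

/-- The Dehn twist generators `ζ₁, …, ζ₅` (indexed by `Fin 5`, so `ζ 0 = ζ₁`, …). -/
def ζ (i : Fin 5) : Map₂ := PresentedGroup.of i

/-- The hyperelliptic involution `I = ζ₁ζ₂ζ₃ζ₄ζ₅²ζ₄ζ₃ζ₂ζ₁` as an element of `Map₂`. -/
def Ihe : Map₂ := ζ 0 * ζ 1 * ζ 2 * ζ 3 * ζ 4 * ζ 4 * ζ 3 * ζ 2 * ζ 1 * ζ 0

/-- The separating Dehn twist `σ = (ζ₁ζ₂)⁶`. -/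
def σ : Map₂ := (ζ 0 * ζ 1) ^ 6

/-- The factorization `T = ζ₁·ζ₂·ζ₃·ζ₄·ζ₅·ζ₅·ζ₄·ζ₃·ζ₂·ζ₁`. -/
def T : List Map₂ := [ζ 0, ζ 1, ζ 2, ζ 3, ζ 4, ζ 4, ζ 3, ζ 2, ζ 1, ζ 0]

/-- The factorization `W₀ = (T)²`. -/
def W₀ : List Map₂ := T ++ T

/-- The factorization `W₁ = (ζ₁·ζ₂·ζ₃·ζ₄·ζ₅)⁶`. -/
def W₁ : List Map₂ := fpow [ζ 0, ζ 1, ζ 2, ζ 3, ζ 4] 6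

/-- The factorization `Φ_f = ζ₃·ζ₄·ζ₅·ζ₂·ζ₃·ζ₄·ζ₁·ζ₂·ζ₃`. -/
def Φf : List Map₂ := [ζ 2, ζ 3, ζ 4, ζ 1, ζ 2, ζ 3, ζ 0, ζ 1, ζ 2]

/-- The factorization `W₂ = σ·(ζ₃·ζ₄·ζ₅·ζ₂·ζ₃·ζ₄·ζ₁·ζ₂·ζ₃)²·T`. -/
def W₂ : List Map₂ := σ :: (Φf ++ Φf ++ T)

namespace HurwitzAux

section Generic
variable {G : Type*} [Group G]

theorem he_refl (F : List G) : HurwitzEquiv F F := Relation.EqvGen.refl _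

theorem he_symm {F F' : List G} (h : HurwitzEquiv F F') : HurwitzEquiv F' F :=
  Relation.EqvGen.symm _ _ h

theorem he_trans {F F' F'' : List G} (h : HurwitzEquiv F F') (h' : HurwitzEquiv F' F'') :
    HurwitzEquiv F F'' := Relation.EqvGen.trans _ _ _ h h'

theorem he_append {F F' : List G} (h : HurwitzEquiv F F') (L R : List G) :
    HurwitzEquiv (L ++ F ++ R) (L ++ F' ++ R) := by
  induction h with
  | rel x y h =>
    obtain ⟨l₁, l₂, a, b, rfl, rfl⟩ := h
    exact Relation.EqvGen.rel _ _ ⟨L ++ l₁, l₂ ++ R, a, b, by simp, by simp⟩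
  | refl x => exact he_refl _
  | symm x y _ ih => exact he_symm ih
  | trans x y z _ _ ih1 ih2 => exact he_trans ih1 ih2

theorem he_left {F F' : List G} (h : HurwitzEquiv F F') (L : List G) :
    HurwitzEquiv (L ++ F) (L ++ F') := by
  simpa using he_append h L []

theorem he_right {F F' : List G} (h : HurwitzEquiv F F') (R : List G) :
    HurwitzEquiv (F ++ R) (F' ++ R) := by
  simpa using he_append h [] R

theorem he_cons {F F' : List G} (h : HurwitzEquiv F F') (a : G) :
    HurwitzEquiv (a :: F) (a :: F') := he_left h [a]

theorem move (a b : G) (R : List G) :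
    HurwitzEquiv (a :: b :: R) ((a * b * a⁻¹) :: a :: R) :=
  Relation.EqvGen.rel _ _ ⟨[], R, a, b, rfl, rfl⟩

/-- Move one conjugated entry to the left across a factorization. -/
theorem pass_one (F : List G) (x : G) :
    HurwitzEquiv (F ++ [F.prod⁻¹ * x * F.prod]) (x :: F) := by
  induction F generalizing x with
  | nil => simpa using he_refl _
  | cons a F ih =>
    have h1 := he_cons (ih (a⁻¹ * x * a)) a
    have h2 := move a (a⁻¹ * x * a) F
    have e : a * (a⁻¹ * x * a) * a⁻¹ = x := by group
    rw [e] at h2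
    have h3 := he_trans h1 h2
    simpa [mul_assoc] using h3

/-- Move a conjugated factorization to the left across a factorization. -/
theorem pass (F X : List G) :
    HurwitzEquiv (F ++ fconj X F.prod) (X ++ F) := by
  induction X with
  | nil => simpa [fconj] using he_refl F
  | cons x X ih =>
    have h1 := he_right (pass_one F x) (fconj X F.prod)
    have h2 := he_cons ih x
    have h3 := he_trans h1 h2
    simpa [fconj] using h3

theorem fpow_succ (B : List G) (n : ℕ) : fpow B (n + 1) = B ++ fpow B n := by
  simp [fpow, List.replicate_succ]

theorem fpow_add (B : List G) (m n : ℕ) : fpow B (m + n) = fpow B m ++ fpow B n := by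
  rw [fpow, List.replicate_add, List.flatten_append]; rfl

theorem fpow_one (B : List G) : fpow B 1 = B := by
  simp [fpow]

theorem fpow_prod (B : List G) (n : ℕ) : (fpow B n).prod = B.prod ^ n := by
  simp [fpow, List.prod_flatten]

theorem step (A B P : List G) (n : ℕ) (h : HurwitzEquiv P (fpow A n ++ fpow B n)) :
    HurwitzEquiv (P ++ fconj (A ++ B) (B.prod ^ n)) (fpow A (n + 1) ++ fpow B (n + 1)) := by
  have h1 := he_right h (fconj (A ++ B) (B.prod ^ n))
  have h2 := he_left (pass (fpow B n) (A ++ B)) (fpow A n)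
  rw [fpow_prod] at h2
  rw [fpow_add A, fpow_one, fpow_succ B]
  simp only [List.append_assoc] at h1 h2 ⊢
  exact he_trans h1 h2

theorem braid_move {a b : G} (h : a * b * a = b * a * b) (R : List G) :
    HurwitzEquiv (a :: b :: a :: R) (b :: a :: b :: R) := by
  have e : b * a * b⁻¹ = a⁻¹ * b * a := by
    rw [mul_inv_eq_iff_eq_mul]
    simp only [mul_assoc] at h ⊢
    rw [← h]; simp
  have h6 := he_cons (move b a R) a
  rw [e] at h6
  have h7 := move a (a⁻¹ * b * a) (b :: R)
  have e' : a * (a⁻¹ * b * a) * a⁻¹ = b := by group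
  rw [e'] at h7
  exact he_trans h6 h7

theorem comm_move {a b : G} (h : a * b = b * a) (R : List G) :
    HurwitzEquiv (a :: b :: R) (b :: a :: R) := by
  have h1 := move a b R
  rwa [h, mul_inv_cancel_right] at h1

end Generic

theorem zeta_comm (i j : Fin 5) (h : (i : ℕ) + 2 ≤ (j : ℕ)) : ζ i * ζ j = ζ j * ζ i := by
  have h1 : (PresentedGroup.mk map2Rels) (fg i * fg j * (fg i)⁻¹ * (fg j)⁻¹) = 1 :=
    PresentedGroup.one_of_mem (Or.inl ⟨i, j, h, rfl⟩)
  simp only [map_mul, map_inv] at h1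
  exact mul_inv_eq_iff_eq_mul.mp (mul_inv_eq_one.mp h1)

theorem zeta_braid (i : Fin 4) :
    ζ i.castSucc * ζ i.succ * ζ i.castSucc = ζ i.succ * ζ i.castSucc * ζ i.succ := by
  have h1 : (PresentedGroup.mk map2Rels) (fg i.castSucc * fg i.succ * fg i.castSucc *
      (fg i.succ * fg i.castSucc * fg i.succ)⁻¹) = 1 :=
    PresentedGroup.one_of_mem (Or.inr (Or.inl ⟨i, rfl⟩))
  rw [map_mul, map_inv, mul_inv_eq_one] at h1
  simp only [map_mul] at h1
  exact h1

theorem zeta_comm' (i j : Fin 5) (h : (i : ℕ) + 2 ≤ (j : ℕ) ∨ (j : ℕ) + 2 ≤ (i : ℕ)) :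
    ζ i * ζ j = ζ j * ζ i := by
  rcases h with h | h
  · exact zeta_comm i j h
  · exact (zeta_comm j i h).symm

theorem zeta_braid' (i j : Fin 5) (h : (i : ℕ) + 1 = (j : ℕ) ∨ (j : ℕ) + 1 = (i : ℕ)) :
    ζ i * ζ j * ζ i = ζ j * ζ i * ζ j := by
  have key : ∀ i j : Fin 5, (i : ℕ) + 1 = (j : ℕ) → ζ i * ζ j * ζ i = ζ j * ζ i * ζ j := by
    intro i j h
    have hi : (i : ℕ) < 4 := by omega
    have e1 : i = (⟨i, hi⟩ : Fin 4).castSucc := rfl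
    have e2 : j = (⟨i, hi⟩ : Fin 4).succ := by ext; simp [h]
    have := zeta_braid ⟨i, hi⟩
    rwa [← e1, ← e2] at this
  rcases h with h | h
  · exact key i j h
  · exact (key j i h).symm

/-- Apply one Artin relation (commutation or braid) at the front of a word, if possible. -/
def artinFront : List (Fin 5) → List (Fin 5)
  | a :: b :: R =>
    if (a : ℕ) + 2 ≤ (b : ℕ) ∨ (b : ℕ) + 2 ≤ (a : ℕ) then b :: a :: R
    else match R with
      | c :: S =>
        if c = a ∧ ((a : ℕ) + 1 = (b : ℕ) ∨ (b : ℕ) + 1 = (a : ℕ)) then b :: a :: b :: S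
        else a :: b :: c :: S
      | [] => [a, b]
  | l => l

/-- Apply one Artin relation at position `n`. -/
def artinAt : ℕ → List (Fin 5) → List (Fin 5)
  | 0, l => artinFront l
  | _ + 1, [] => []
  | n + 1, a :: l => a :: artinAt n l

theorem artinFront_sound (l : List (Fin 5)) :
    HurwitzEquiv (l.map ζ) ((artinFront l).map ζ) := by
  match l with
  | [] => exact he_refl _
  | [a] => exact he_refl _
  | [a, b] =>
    simp only [artinFront]
    split_ifs with h
    · exact comm_move (zeta_comm' a b h) _
    · exact he_refl _
  | a :: b :: c :: S =>
    simp only [artinFront]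
    split_ifs with h h'
    · exact comm_move (zeta_comm' a b h) _
    · obtain ⟨rfl, h2⟩ := h'
      exact braid_move (zeta_braid' c b h2) _
    · exact he_refl _

theorem artinAt_sound (n : ℕ) (l : List (Fin 5)) :
    HurwitzEquiv (l.map ζ) ((artinAt n l).map ζ) := by
  induction n generalizing l with
  | zero => exact artinFront_sound l
  | succ n ih =>
    cases l with
    | nil => exact he_refl _
    | cons a l => exact he_cons (ih l) (ζ a)

theorem artin_sound (ns : List ℕ) (l : List (Fin 5)) :
    HurwitzEquiv (l.map ζ) ((ns.foldl (fun w n => artinAt n w) l).map ζ) := by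
  induction ns generalizing l with
  | nil => exact he_refl _
  | cons n ns ih => exact he_trans (artinAt_sound n l) (ih _)

/-- Positions of Artin relations turning `(ζ₅ζ₄ζ₃ζ₂ζ₁)⁶` into `(ζ₁ζ₂ζ₃ζ₄ζ₅)⁶`. -/
def certificate : List ℕ :=
   [19, 18, 17, 15, 14, 13, 11, 10, 9, 7, 6, 5, 3, 2, 1, 0, 15, 14, 13, 11, 10, 9, 7, 6, 5, 3,
    2, 1, 11, 10, 9, 7, 6, 5, 3, 2, 7, 6, 5, 3, 16, 15, 13, 12, 10, 9, 7, 6, 5, 13, 12, 10, 9,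
    7, 6, 10, 9, 7, 24, 23, 22, 25, 24, 26, 27, 25, 23, 21, 20, 19, 18, 17, 16, 15, 14, 13,
    12, 11, 10, 9, 15, 13, 11, 10, 13, 11, 21, 20, 23, 22, 25, 24, 27, 26, 25, 23, 21, 19, 18,
    17, 16, 15, 14, 13, 25, 24, 23, 22, 26, 25, 27, 26, 24, 23, 21, 20, 19, 18, 17, 16, 15,
    14, 15, 20, 23, 22, 26, 25, 24, 23, 21, 19, 18, 17, 23, 22, 25, 27, 26, 24, 23, 21, 20,
    19, 18, 26, 25, 24, 27, 26, 25, 23, 22, 21, 20, 19, 25, 24, 23, 21, 26, 25, 23, 22, 27,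
    25, 24, 23, 27, 26, 25, 24]

theorem certificate_ok :
    certificate.foldl (fun w n => artinAt n w) (fpow [4, 3, 2, 1, 0] 6) =
      fpow [0, 1, 2, 3, 4] 6 := by
  decide +kernel

theorem B_equiv_A :
    HurwitzEquiv (fpow [ζ 4, ζ 3, ζ 2, ζ 1, ζ 0] 6) (fpow [ζ 0, ζ 1, ζ 2, ζ 3, ζ 4] 6) := by
  have h := artin_sound certificate (fpow [4, 3, 2, 1, 0] 6)
  rw [certificate_ok] at h
  exact h

end HurwitzAux

/-- `(W₁)² ∼ ∏_{j=0}^{5} (T)_{(ζ₅ζ₄ζ₃ζ₂ζ₁)^j}`. -/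
theorem W1_sq_equiv_conj_T :
    let c : Map₂ := ζ 4 * ζ 3 * ζ 2 * ζ 1 * ζ 0
    HurwitzEquiv (fpow W₁ 2)
      (T ++ fconj T c ++ fconj T (c ^ 2) ++ fconj T (c ^ 3) ++ fconj T (c ^ 4) ++
        fconj T (c ^ 5)) := by
  intro c
  have hc : c = ([ζ 4, ζ 3, ζ 2, ζ 1, ζ 0] : List Map₂).prod := by
    simp [c, mul_assoc]
  have hT : T = [ζ 0, ζ 1, ζ 2, ζ 3, ζ 4] ++ [ζ 4, ζ 3, ζ 2, ζ 1, ζ 0] := rfl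
  rw [hc, hT]
  have h1 := HurwitzAux.step [ζ 0, ζ 1, ζ 2, ζ 3, ζ 4] [ζ 4, ζ 3, ζ 2, ζ 1, ζ 0] _ 1
    (HurwitzAux.he_refl _)
  have h2 := HurwitzAux.step _ _ _ 2 h1
  have h3 := HurwitzAux.step _ _ _ 3 h2
  have h4 := HurwitzAux.step _ _ _ 4 h3
  have h5 := HurwitzAux.step _ _ _ 5 h4
  rw [pow_one, HurwitzAux.fpow_one, HurwitzAux.fpow_one] at h5
  have h6 := HurwitzAux.he_trans h5 (HurwitzAux.he_left HurwitzAux.B_equiv_A _)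
  have hW : fpow W₁ 2 = fpow [ζ 0, ζ 1, ζ 2, ζ 3, ζ 4] 6 ++ fpow [ζ 0, ζ 1, ζ 2, ζ 3, ζ 4] 6 := by
    rw [HurwitzAux.fpow_add W₁ 1 1, HurwitzAux.fpow_one]
    rfl
  rw [hW]
  exact HurwitzAux.he_symm h6
end

section
/- In the sphere braid group B₆(S²), the 18-entry factorization (x₃)²·((x₄)_{x₃})²·((x₅)_{x₄x₃})²·[(x₂)²·((x₃)_{x₂})²·((x₄)_{x₃x₂})²]_{x₅x₄x₃}·[(x₁)²·((x₂)_{x₁})²·((x₃)_{x₂x₁})²]_{x₄x₃x₂x₅x₄x₃} (where (τ)² means the entry τ repeated twice, and [F]_φ means every entry of the list F is conjugated: τ ↦ φ⁻¹τφ) is Hurwitz equivalent to the factorization (x₃·x₄·x₅·x₂·x₃·x₄·x₁·x₂·x₃)². -/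
/-- The word `x₁x₂x₃x₄x₅²x₄x₃x₂x₁` in the free group. -/
def sphereWord : FreeGroup (Fin 5) :=
  fg 0 * fg 1 * fg 2 * fg 3 * fg 4 * fg 4 * fg 3 * fg 2 * fg 1 * fg 0

/-- Relations for the presentation of the sphere braid group `B₆(S²)`:
commutations `xᵢxⱼ = xⱼxᵢ` for `|i - j| ≥ 2`, braid relations `xᵢxᵢ₊₁xᵢ = xᵢ₊₁xᵢxᵢ₊₁`,
and `x₁x₂x₃x₄x₅²x₄x₃x₂x₁ = 1`. -/
def braidRels : Set (FreeGroup (Fin 5)) :=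
  { r | (∃ i j : Fin 5, (i : ℕ) + 2 ≤ (j : ℕ) ∧ r = fg i * fg j * (fg i)⁻¹ * (fg j)⁻¹) ∨
        (∃ i : Fin 4, r = fg i.castSucc * fg i.succ * fg i.castSucc *
          (fg i.succ * fg i.castSucc * fg i.succ)⁻¹) ∨
        r = sphereWord }

/-- The braid group of the sphere on 6 strands, via its standard presentation. -/
abbrev SphereBraid₆ : Type := PresentedGroup braidRels

/-- The half-twist generators `x₁, …, x₅` (indexed by `Fin 5`, so `x 0 = x₁`, …). -/
def x (i : Fin 5) : SphereBraid₆ := PresentedGroup.of i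

/-- Conjugation `(τ)_φ = φ⁻¹ τ φ`. -/
def bconj (τ φ : SphereBraid₆) : SphereBraid₆ := φ⁻¹ * τ * φ

theorem HE.app {G : Type*} [Group G] {F F' : List G} (h : HurwitzEquiv F F') (l r : List G) :
    HurwitzEquiv (l ++ F ++ r) (l ++ F' ++ r) := by
  induction h with
  | rel a b h =>
    obtain ⟨l₁, l₂, u, v, rfl, rfl⟩ := h
    exact Relation.EqvGen.rel _ _ ⟨l ++ l₁, l₂ ++ r, u, v, by simp, by simp⟩
  | refl a => exact Relation.EqvGen.refl _
  | symm a b _ ih => exact Relation.EqvGen.symm _ _ ih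
  | trans a b c _ _ ih1 ih2 => exact Relation.EqvGen.trans _ _ _ ih1 ih2

theorem HE.cons {G : Type*} [Group G] {F F' : List G} (a : G) (h : HurwitzEquiv F F') :
    HurwitzEquiv (a :: F) (a :: F') := by
  simpa using HE.app h [a] []

theorem HE.refl {G : Type*} [Group G] (F : List G) : HurwitzEquiv F F := Relation.EqvGen.refl _

theorem HE.trans {G : Type*} [Group G] {F F' F'' : List G} (h : HurwitzEquiv F F')
    (h' : HurwitzEquiv F' F'') : HurwitzEquiv F F'' := Relation.EqvGen.trans _ _ _ h h'

/-- Moving a single entry to the right past a conjugated list. -/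
theorem HE.one {G : Type*} [Group G] (a : G) (F : List G) :
    HurwitzEquiv (a :: fconj F a) (F ++ [a]) := by
  induction F with
  | nil => exact Relation.EqvGen.refl _
  | cons b F ih =>
    refine HE.trans (Relation.EqvGen.rel _ (b :: a :: fconj F a) ?_) (HE.cons b ih)
    exact ⟨[], fconj F a, a, a⁻¹ * b * a, by simp [fconj], by simp [mul_assoc]⟩

/-- Moving a list to the right past a list conjugated by its product. -/
theorem HE.many {G : Type*} [Group G] (P F : List G) :
    HurwitzEquiv (P ++ fconj F P.prod) (F ++ P) := by
  induction P generalizing F with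
  | nil => simpa [fconj] using HE.refl F
  | cons a P ih =>
    have h1 := HE.cons a (ih (fconj F a))
    have h2 := HE.app (HE.one a F) [] P
    refine HE.trans ?_ (HE.trans h1 (by simpa using h2))
    have : fconj (fconj F a) P.prod = fconj F (a :: P).prod := by
      simp [fconj, mul_assoc]
    rw [this]
    exact Relation.EqvGen.refl _

theorem HE.block {G : Type*} [Group G] (a b c : G) :
    HurwitzEquiv [a, a, a⁻¹ * b * a, a⁻¹ * b * a, (b * a)⁻¹ * c * (b * a), (b * a)⁻¹ * c * (b * a)]
      [a, b, c, c, b, a] := by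
  have h1 := HE.cons a (HE.one a [b, b, b⁻¹ * c * b, b⁻¹ * c * b])
  have h2 := HE.app (HE.one b [c, c]) [a, b] [a]
  refine HE.trans ?_ (HE.trans h1 (by simpa [fconj] using h2))
  simpa [fconj, mul_assoc] using HE.refl _

theorem HE.swap {G : Type*} [Group G] (a b : G) (h : a * b = b * a) (l r : List G) :
    HurwitzEquiv (l ++ a :: b :: r) (l ++ b :: a :: r) :=
  Relation.EqvGen.rel _ _ ⟨l, r, a, b, rfl, by rw [h]; simp⟩

theorem x_comm (i j : Fin 5) (h : (i : ℕ) + 2 ≤ j) : x i * x j = x j * x i := by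
  have : PresentedGroup.mk braidRels (fg i * fg j * (fg i)⁻¹ * (fg j)⁻¹) = 1 :=
    PresentedGroup.one_of_mem (Or.inl ⟨i, j, h, rfl⟩)
  simp only [map_mul, map_inv] at this
  change x i * x j * (x i)⁻¹ * (x j)⁻¹ = 1 at this
  rw [mul_inv_eq_one, mul_inv_eq_iff_eq_mul] at this
  exact this

theorem HE.rev :
    HurwitzEquiv [x 2, x 1, x 0, x 3, x 2, x 1, x 4, x 3, x 2]
      [x 2, x 3, x 4, x 1, x 2, x 3, x 0, x 1, x 2] := by
  refine HE.trans (HE.swap (x 0) (x 3) (x_comm 0 3 (by decide)) [x 2, x 1] [x 2, x 1, x 4, x 3, x 2]) ?_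
  refine HE.trans (HE.swap (x 1) (x 3) (x_comm 1 3 (by decide)) [x 2] [x 0, x 2, x 1, x 4, x 3, x 2]) ?_
  refine HE.trans (HE.swap (x 1) (x 4) (x_comm 1 4 (by decide)) [x 2, x 3, x 1, x 0, x 2] [x 3, x 2]) ?_
  refine HE.trans (HE.swap (x 2) (x 4) (x_comm 2 4 (by decide)) [x 2, x 3, x 1, x 0] [x 1, x 3, x 2]) ?_
  refine HE.trans (HE.swap (x 0) (x 4) (x_comm 0 4 (by decide)) [x 2, x 3, x 1] [x 2, x 1, x 3, x 2]) ?_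
  refine HE.trans (HE.swap (x 1) (x 4) (x_comm 1 4 (by decide)) [x 2, x 3] [x 0, x 2, x 1, x 3, x 2]) ?_
  refine HE.trans (HE.swap (x 0) (x 2) (x_comm 0 2 (by decide)) [x 2, x 3, x 4, x 1] [x 1, x 3, x 2]) ?_
  refine HE.trans (HE.swap (x 1) (x 3) (x_comm 1 3 (by decide)) [x 2, x 3, x 4, x 1, x 2, x 0] [x 2]) ?_
  refine HE.trans (HE.swap (x 0) (x 3) (x_comm 0 3 (by decide)) [x 2, x 3, x 4, x 1, x 2] [x 1, x 2]) ?_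
  exact Relation.EqvGen.refl _

/-- In `B₆(S²)`, the 18-entry factorization coming from the 9 nodes of the degenerated
curve `D₂` is Hurwitz equivalent to `(x₃·x₄·x₅·x₂·x₃·x₄·x₁·x₂·x₃)²`. -/
theorem braid_factorization_nodes :
    HurwitzEquiv
      ([x 2, x 2,
        bconj (x 3) (x 2), bconj (x 3) (x 2),
        bconj (x 4) (x 3 * x 2), bconj (x 4) (x 3 * x 2)] ++
       fconj [x 1, x 1,
              bconj (x 2) (x 1), bconj (x 2) (x 1),
              bconj (x 3) (x 2 * x 1), bconj (x 3) (x 2 * x 1)] (x 4 * x 3 * x 2) ++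
       fconj [x 0, x 0,
              bconj (x 1) (x 0), bconj (x 1) (x 0),
              bconj (x 2) (x 1 * x 0), bconj (x 2) (x 1 * x 0)]
             (x 3 * x 2 * x 1 * x 4 * x 3 * x 2))
      (fpow [x 2, x 3, x 4, x 1, x 2, x 3, x 0, x 1, x 2] 2) := by
  have c1 := HE.block (x 2) (x 3) (x 4)
  have c2 := HE.block (x 1) (x 2) (x 3)
  have c3 := HE.block (x 0) (x 1) (x 2)
  simp only [bconj] at *
  set B1 := [x 2, x 2, (x 2)⁻¹ * x 3 * x 2, (x 2)⁻¹ * x 3 * x 2,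
    (x 3 * x 2)⁻¹ * x 4 * (x 3 * x 2), (x 3 * x 2)⁻¹ * x 4 * (x 3 * x 2)]
  set B2 := [x 1, x 1, (x 1)⁻¹ * x 2 * x 1, (x 1)⁻¹ * x 2 * x 1,
    (x 2 * x 1)⁻¹ * x 3 * (x 2 * x 1), (x 2 * x 1)⁻¹ * x 3 * (x 2 * x 1)]
  set B3 := [x 0, x 0, (x 0)⁻¹ * x 1 * x 0, (x 0)⁻¹ * x 1 * x 0,
    (x 1 * x 0)⁻¹ * x 2 * (x 1 * x 0), (x 1 * x 0)⁻¹ * x 2 * (x 1 * x 0)]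
  have m2 := HE.many [x 4, x 3, x 2] B2
  have m3 := HE.many [x 3, x 2, x 1, x 4, x 3, x 2] B3
  rw [show [x 4, x 3, x 2].prod = x 4 * x 3 * x 2 by simp [mul_assoc]] at m2
  rw [show [x 3, x 2, x 1, x 4, x 3, x 2].prod = x 3 * x 2 * x 1 * x 4 * x 3 * x 2 by
    simp [mul_assoc]] at m3
  set D2 := fconj B2 (x 4 * x 3 * x 2)
  set D3 := fconj B3 (x 3 * x 2 * x 1 * x 4 * x 3 * x 2)
  refine HE.trans (F' := [x 2, x 3, x 4, x 4, x 3, x 2] ++ D2 ++ D3) ?_ ?_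
  · simpa using HE.app c1 [] (D2 ++ D3)
  refine HE.trans (F' := [x 2, x 3, x 4] ++ B2 ++ [x 4, x 3, x 2] ++ D3) ?_ ?_
  · simpa using HE.app m2 [x 2, x 3, x 4] D3
  refine HE.trans (F' := [x 2, x 3, x 4, x 1, x 2, x 3, x 3, x 2, x 1, x 4, x 3, x 2] ++ D3) ?_ ?_
  · simpa using HE.app c2 [x 2, x 3, x 4] ([x 4, x 3, x 2] ++ D3)
  refine HE.trans (F' := [x 2, x 3, x 4, x 1, x 2, x 3] ++ B3 ++ [x 3, x 2, x 1, x 4, x 3, x 2])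
    ?_ ?_
  · simpa using HE.app m3 [x 2, x 3, x 4, x 1, x 2, x 3] []
  refine HE.trans (HE.app c3 [x 2, x 3, x 4, x 1, x 2, x 3] [x 3, x 2, x 1, x 4, x 3, x 2]) ?_
  exact HE.app HE.rev [x 2, x 3, x 4, x 1, x 2, x 3, x 0, x 1, x 2] []
end
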